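/- arXiv:2605.04197 — 6 statements merged into one kernel-verified Lean document; each statement's English description precedes it below -/
import Mathlib

section
/- Let n be a positive integer, J an n×n complex matrix, η a complex number, and let M be the 2n×2n block matrix M = [[0, Jᵀ],[I, −ηI]]. Then μ ∈ ℂ is an eigenvalue of M if and only if μ(η + μ) is an eigenvalue of J. -/
open Matrix

/-- A square matrix over a field and its transpose have the same eigenvalues. -/
theorem Matrix.exists_transpose_mulVec_eq_smul_iff {m K : Type*} [Fintype m] [DecidableEq m]
    [Field K] (A : Matrix m m K) (c : K) :
    (∃ v, v ≠ 0 ∧ Aᵀ *ᵥ v = c • v) ↔ ∃ v, v ≠ 0 ∧ A *ᵥ v = c • v := by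
  have eigen_iff_det (B : Matrix m m K) :
      (∃ v, v ≠ 0 ∧ B *ᵥ v = c • v) ↔ (B - c • (1 : Matrix m m K)).det = 0 := by
    simp only [← Matrix.exists_mulVec_eq_zero_iff, Matrix.sub_mulVec, Matrix.smul_mulVec,
      Matrix.one_mulVec, sub_eq_zero]
  rw [eigen_iff_det, eigen_iff_det, ← Matrix.det_transpose (A - _)]
  simp

/-- The eigenvalue equation of the companion-type block matrix `[[0, A], [1, -η]]`, in
coordinates. -/
theorem Matrix.fromBlocks_zero_one_mulVec_eq_smul_iff {m R : Type*} [Fintype m] [DecidableEq m]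
    [CommRing R] (A : Matrix m m R) (η μ : R) (ξ w : m → R) :
    Matrix.fromBlocks 0 A 1 ((-η) • (1 : Matrix m m R)) *ᵥ Sum.elim ξ w = μ • Sum.elim ξ w ↔
      ξ = (η + μ) • w ∧ A *ᵥ w = (μ * (η + μ)) • w := by
  have h_smul : μ • Sum.elim ξ w = Sum.elim (μ • ξ) (μ • w) := by
    ext (i | i) <;> rfl
  rw [h_smul, Matrix.fromBlocks_mulVec, Sum.elim_eq_iff]
  simp only [Sum.elim_comp_inl, Sum.elim_comp_inr, Matrix.zero_mulVec, zero_add,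
    Matrix.one_mulVec, Matrix.smul_mulVec]
  have h_snd : ξ + -η • w = μ • w ↔ ξ = (η + μ) • w := by
    rw [neg_smul, ← sub_eq_add_neg, sub_eq_iff_eq_add, add_smul, add_comm]
  rw [h_snd, and_comm, mul_smul]
  exact and_congr_right fun h => by rw [h]

/-- For the block matrix `M = [[0, Jᵀ],[I, −ηI]]` acting on `ℂ²ⁿ = ℂⁿ × ℂⁿ`,
`μ` is an eigenvalue of `M` if and only if `μ(η + μ)` is an eigenvalue of `J`. -/
theorem stmt2 (n : ℕ) (hn : 0 < n) (J : Matrix (Fin n) (Fin n) ℂ) (η μ : ℂ) :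
    (∃ x : (Fin n ⊕ Fin n) → ℂ, x ≠ 0 ∧
      (Matrix.fromBlocks (0 : Matrix (Fin n) (Fin n) ℂ) Jᵀ
          (1 : Matrix (Fin n) (Fin n) ℂ) ((-η) • (1 : Matrix (Fin n) (Fin n) ℂ))).mulVec x
        = μ • x) ↔
    (∃ v : Fin n → ℂ, v ≠ 0 ∧ J.mulVec v = (μ * (η + μ)) • v) := by
  rw [← Matrix.exists_transpose_mulVec_eq_smul_iff J]
  constructor
  · rintro ⟨x, hx, h⟩
    rw [← Sum.elim_comp_inl_inr x, Matrix.fromBlocks_zero_one_mulVec_eq_smul_iff] at h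
    refine ⟨x ∘ Sum.inr, fun hw => hx ?_, h.2⟩
    rw [← Sum.elim_comp_inl_inr x, h.1, hw, smul_zero, Sum.elim_zero_zero]
  · rintro ⟨w, hw, h⟩
    refine ⟨Sum.elim ((η + μ) • w) w, fun hx => hw ?_,
      (Matrix.fromBlocks_zero_one_mulVec_eq_smul_iff _ _ _ _ _).2 ⟨rfl, h⟩⟩
    simpa using congrArg (· ∘ Sum.inr) hx
end

section
/- Let f : ℝⁿ → ℝⁿ be differentiable at p ∈ ℝⁿ with Jacobian matrix Df(p). Define the gentlest ascent dynamics (GAD) vector field on ℝⁿ × ℝⁿ × ℝⁿ by G(x, v, w) = ( f(x) − 2(⟨f(x), w⟩/⟨w, v⟩)v, Df(x)v − α(x, v)v, Df(x)ᵀw − β(x, v, w)w ), where α(x, v) = ⟨v, Df(x)v⟩ and β(x, v, w) = 2⟨w, Df(x)v⟩ − α(x, v), and ⟨·,·⟩ is the standard inner product on ℝⁿ. Suppose f(p) = 0, and v₁, w₁ ∈ ℝⁿ satisfy Df(p)v₁ = λ₁v₁, Df(p)ᵀw₁ = λ₁w₁ for some λ₁ ∈ ℝ, with ⟨v₁, v₁⟩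 = ⟨v₁, w₁⟩ = 1. Then G(p, v₁, w₁) = 0, i.e., (p, v₁, w₁) is an equilibrium of the GAD system. -/
open RealInnerProductSpace

/-- If `p` is an equilibrium of `f` and `v₁, w₁` are right and left eigenvectors
of `Df(p)` for the eigenvalue `λ₁`, normalized by `⟨v₁,v₁⟩ = ⟨v₁,w₁⟩ = 1`, then `(p, v₁, w₁)` is
an equilibrium of the gentlest ascent dynamics (GAD) vector field. -/
theorem stmt3 (n : ℕ)
    (f : EuclideanSpace ℝ (Fin n) → EuclideanSpace ℝ (Fin n))
    (p v₁ w₁ : EuclideanSpace ℝ (Fin n))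
    (A : EuclideanSpace ℝ (Fin n) →L[ℝ] EuclideanSpace ℝ (Fin n))
    (hA : HasFDerivAt f A p) (lam₁ : ℝ)
    (hfp : f p = 0)
    (hv : A v₁ = lam₁ • v₁)
    (hw : ContinuousLinearMap.adjoint A w₁ = lam₁ • w₁)
    (hvv : ⟪v₁, v₁⟫ = 1) (hvw : ⟪v₁, w₁⟫ = 1) :
    f p - (2 * ⟪f p, w₁⟫ / ⟪w₁, v₁⟫) • v₁ = 0 ∧
    A v₁ - ⟪v₁, A v₁⟫ • v₁ = 0 ∧
    ContinuousLinearMap.adjoint A w₁ - (2 * ⟪w₁, A v₁⟫ - ⟪v₁, A v₁⟫) • w₁ = 0 := by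
  have hwv : ⟪w₁, v₁⟫ = 1 := by rw [real_inner_comm, hvw]
  have hα : ⟪v₁, A v₁⟫ = lam₁ := by rw [hv, real_inner_smul_right, hvv, mul_one]
  have hβ : ⟪w₁, A v₁⟫ = lam₁ := by rw [hv, real_inner_smul_right, hwv, mul_one]
  refine ⟨by simp [hfp], by rw [hα, hv, sub_self], ?_⟩
  rw [hα, hβ, hw, two_mul, add_sub_cancel_right, sub_self]
end

section
/- Let f : ℝⁿ → ℝⁿ be differentiable at p ∈ ℝⁿ with Jacobian matrix Df(p), and define the GAD vector field G(x, v, w) = ( f(x) − 2(⟨f(x), w⟩/⟨w, v⟩)v, Df(x)v − α(x, v)v, Df(x)ᵀw − β(x, v, w)w ), where α(x, v) = ⟨v, Df(x)v⟩ and β(x, v, w) = 2⟨w, Df(x)v⟩ − α(x, v). Suppose v, w ∈ ℝⁿ satisfy ⟨v, v⟩ = ⟨v, w⟩ = 1 and G(p, v, w) = 0. Then, with α = ⟨v, Df(p)v⟩: (i) β(p, v, w) = α; (ii) Df(p)v = αv; (iii) Df(p)ᵀw = αw; and (iv) f(p) = 0. -/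
open RealInnerProductSpace

/-- converse direction of the GAD theorem, algebraic content.
If `⟨v,v⟩ = ⟨v,w⟩ = 1` and `(p, v, w)` is an equilibrium of the GAD vector field, then with
`α = ⟨v, Df(p)v⟩`: (i) `β(p,v,w) = α`; (ii) `Df(p)v = αv`; (iii) `Df(p)ᵀw = αw`;
(iv) `f(p) = 0`. -/
theorem stmt4 (n : ℕ)
    (f : EuclideanSpace ℝ (Fin n) → EuclideanSpace ℝ (Fin n))
    (p v w : EuclideanSpace ℝ (Fin n))
    (A : EuclideanSpace ℝ (Fin n) →L[ℝ] EuclideanSpace ℝ (Fin n))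
    (hA : HasFDerivAt f A p)
    (hvv : ⟪v, v⟫ = 1) (hvw : ⟪v, w⟫ = 1)
    (hG1 : f p - (2 * ⟪f p, w⟫ / ⟪w, v⟫) • v = 0)
    (hG2 : A v - ⟪v, A v⟫ • v = 0)
    (hG3 : ContinuousLinearMap.adjoint A w - (2 * ⟪w, A v⟫ - ⟪v, A v⟫) • w = 0) :
    2 * ⟪w, A v⟫ - ⟪v, A v⟫ = ⟪v, A v⟫ ∧
    A v = ⟪v, A v⟫ • v ∧
    ContinuousLinearMap.adjoint A w = ⟪v, A v⟫ • w ∧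
    f p = 0 := by
  have hwv : ⟪w, v⟫ = 1 := by rw [real_inner_comm, hvw]
  have hAv : A v = ⟪v, A v⟫ • v := sub_eq_zero.mp hG2
  have hwAv : ⟪w, A v⟫ = ⟪v, A v⟫ := by
    conv_lhs => rw [hAv]
    rw [real_inner_smul_right, hwv, mul_one]
  have hβ : 2 * ⟪w, A v⟫ - ⟪v, A v⟫ = ⟪v, A v⟫ := by linarith
  have hf : f p = (2 * ⟪f p, w⟫) • v := by
    rw [hwv, div_one] at hG1
    exact sub_eq_zero.mp hG1
  have hfw : ⟪f p, w⟫ = 0 := by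
    have h := congrArg (fun u => ⟪u, w⟫) hf
    simp only [real_inner_smul_left, hvw] at h
    linarith
  refine ⟨hβ, hAv, ?_, ?_⟩
  · rw [hβ] at hG3
    exact sub_eq_zero.mp hG3
  · rw [hf, hfw, mul_zero, zero_smul]
end

section
/- Let T > 0, n ≥ 1, and let A : ℝ → (n×n complex matrices) be continuous and T-periodic. Let λ, μ ∈ ℂ. Suppose: w : ℝ → ℂⁿ is continuously differentiable and T-periodic with A(t)ᵀw(t) + w′(t) = λ·w(t) for all t; v : ℝ → ℂⁿ is twice continuously differentiable and T-periodic with ∫₀ᵀ w(t) · v(t) dt = 1; and v¹ : ℝ → ℂⁿ is continuously differentiable and T-periodic with A(t)v¹(t) − (v¹)′(t) − λ·v¹(t) = −v″(t) + μ·v(t) for all t. Then μ = ∫₀ᵀ w(t) · v″(t) dt, where u · v denotes the complex bilinear (unconjugated) dot product on ℂⁿ. -/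
open Matrix

/-- Product rule for the bilinear dot product of vector-valued functions. -/
theorem HasDerivAt.dotProduct {ι : Type*} [Fintype ι] {f g : ℝ → ι → ℂ} {f' g' : ι → ℂ} {t : ℝ}
    (hf : HasDerivAt f f' t) (hg : HasDerivAt g g' t) :
    HasDerivAt (fun s => f s ⬝ᵥ g s) (f' ⬝ᵥ g t + f t ⬝ᵥ g') t := by
  simp only [_root_.dotProduct, ← Finset.sum_add_distrib]
  exact HasDerivAt.fun_sum fun i _ => (hasDerivAt_pi.1 hf i).mul (hasDerivAt_pi.1 hg i)

/-- The derivative of a periodic function has zero integral over a period. -/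
theorem Function.Periodic.intervalIntegral_deriv_eq_zero {f f' : ℝ → ℂ} {T : ℝ}
    (hf : Function.Periodic f T) (hderiv : ∀ t, HasDerivAt f (f' t) t) (hcont : Continuous f') :
    ∫ t in (0:ℝ)..T, f' t = 0 := by
  rw [intervalIntegral.integral_eq_sub_of_hasDerivAt (fun t _ => hderiv t)
    (hcont.intervalIntegrable 0 T), hf.eq, sub_self]

/-- Pairing the inhomogeneous equation `Bu − u′ − λu = −g + μv` with an adjoint eigenvector. -/
theorem dotProduct_eq_of_adjoint_eigenvector {ι : Type*} [Fintype ι] {B : Matrix ι ι ℂ}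
    {lam mu : ℂ} {w w' u u' v g : ι → ℂ} (hw : Bᵀ *ᵥ w + w' = lam • w)
    (hu : B *ᵥ u - u' - lam • u = -g + mu • v) :
    w ⬝ᵥ g = mu * (w ⬝ᵥ v) + (w' ⬝ᵥ u + w ⬝ᵥ u') := by
  have h₁ := congrArg (w ⬝ᵥ ·) hu
  have h₂ := congrArg (· ⬝ᵥ u) hw
  simp only [dotProduct_sub, dotProduct_add, dotProduct_neg, dotProduct_smul, add_dotProduct,
    smul_dotProduct, smul_eq_mul, mulVec_transpose, dotProduct_mulVec] at h₁ h₂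
  linear_combination h₁ - h₂

/-- first-order eigenvalue perturbation formula `λ⁽¹⁾ = ⟪w, v″⟫`.
If `w` is a `T`-periodic adjoint eigenfunction (`Aᵀw + w′ = λw`), `v` is `T`-periodic with
`∫₀ᵀ w·v dt = 1`, and `v¹` is a `T`-periodic solution of the first-order equation
`Av¹ − (v¹)′ − λv¹ = −v″ + μv`, then `μ = ∫₀ᵀ w·v″ dt`. -/
theorem stmt10 (n : ℕ) (hn : 1 ≤ n) (T : ℝ) (hT : 0 < T)
    (A : ℝ → Matrix (Fin n) (Fin n) ℂ) (hA : Continuous A) (hAp : Function.Periodic A T)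
    (lam mu : ℂ) (w v v1 : ℝ → Fin n → ℂ)
    (hw : ContDiff ℝ 1 w) (hwp : Function.Periodic w T)
    (hweig : ∀ t : ℝ, (A t)ᵀ.mulVec (w t) + deriv w t = lam • w t)
    (hv : ContDiff ℝ 2 v) (hvp : Function.Periodic v T)
    (hnorm : (∫ t in (0:ℝ)..T, w t ⬝ᵥ v t) = 1)
    (hv1 : ContDiff ℝ 1 v1) (hv1p : Function.Periodic v1 T)
    (heq : ∀ t : ℝ, (A t).mulVec (v1 t) - deriv v1 t - lam • v1 t
      = -(deriv (deriv v) t) + mu • v t) :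
    mu = ∫ t in (0:ℝ)..T, w t ⬝ᵥ deriv (deriv v) t := by
  have hwd (t : ℝ) : HasDerivAt w (deriv w t) t :=
    (hw.differentiable one_ne_zero t).hasDerivAt
  have hv1d (t : ℝ) : HasDerivAt v1 (deriv v1 t) t :=
    (hv1.differentiable one_ne_zero t).hasDerivAt
  have hwv : Continuous fun t => w t ⬝ᵥ v t := hw.continuous.dotProduct hv.continuous
  have hcont : Continuous fun t => deriv w t ⬝ᵥ v1 t + w t ⬝ᵥ deriv v1 t :=
    ((hw.continuous_deriv le_rfl).dotProduct hv1.continuous).add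
      (hw.continuous.dotProduct (hv1.continuous_deriv le_rfl))
  have hper : Function.Periodic (fun t => w t ⬝ᵥ v1 t) T := fun t => by
    simp only [hwp t, hv1p t]
  have hzero := hper.intervalIntegral_deriv_eq_zero (fun t => (hwd t).dotProduct (hv1d t)) hcont
  simp only [fun t => dotProduct_eq_of_adjoint_eigenvector (hweig t) (heq t)]
  rw [intervalIntegral.integral_add ((hwv.const_mul mu).intervalIntegrable 0 T)
    (hcont.intervalIntegrable 0 T), hzero, intervalIntegral.integral_const_mul, hnorm,
    mul_one, add_zero]
end

section
/- Let s₀ > 0, λ₀ > 0, δ ∈ (0, λ₀), K > 0, ε > 0. Let a, b : [0, s₀] → ℝ be locally Lipschitz functions with a(s) ≥ ε and b(s) ≥ 0 for all s, and b(0) = 0. Suppose that for almost every s ∈ [0, s₀): a′(s) ≥ (λ₀/2)·a(s) and b′(s) ≤ (λ₀ − δ)·b(s) + 2K·a(s)². Then for every s ∈ [0, s₀], b(s) ≤ (2K/δ)·(1 − e^{−δs})·a(s)²; in particular b(s)/a(s)² < 2K/δ for all s. -/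
open Set

/-- An absolutely continuous function whose derivative is a.e. nonpositive does not increase. -/
theorem AbsolutelyContinuousOnInterval.le_of_ae_deriv_nonpos {f : ℝ → ℝ} {u v : ℝ}
    (hf : AbsolutelyContinuousOnInterval f u v) (huv : u ≤ v)
    (h : ∀ᵐ x ∂MeasureTheory.volume, x ∈ Ico u v → deriv f x ≤ 0) : f v ≤ f u := by
  have hint : ∫ x in u..v, deriv f x ≤ 0 := by
    rw [intervalIntegral.integral_of_le huv, ← MeasureTheory.integral_Ico_eq_integral_Ioc]
    exact MeasureTheory.integral_nonpos_of_ae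
      ((MeasureTheory.ae_restrict_iff' measurableSet_Ico).2 h)
  rw [hf.integral_deriv_eq_sub] at hint
  linarith

theorem lipschitzOnWith_inv_Ici {ε : ℝ} (hε : 0 < ε) :
    LipschitzOnWith (Real.toNNReal (1 / ε ^ 2)) (fun x : ℝ ↦ x⁻¹) (Ici ε) := by
  refine LipschitzOnWith.of_dist_le_mul fun x hx y hy ↦ ?_
  have hx' : ε ≤ x := hx
  have hy' : ε ≤ y := hy
  have hx0 : 0 < x := hε.trans_le hx'
  have hy0 : 0 < y := hε.trans_le hy'
  rw [Real.coe_toNNReal _ (by positivity), dist_inv_inv₀ hx0.ne' hy0.ne', Real.norm_eq_abs,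
    Real.norm_eq_abs, abs_of_pos hx0, abs_of_pos hy0, div_eq_inv_mul, one_div]
  gcongr
  nlinarith

/-- Pointwise differential inequality for the weighted ratio `e^{δs} (b / a² - 2K/δ)`. -/
theorem deriv_exp_mul_ratio_nonpos {a b : ℝ → ℝ} {lam δ K x : ℝ} (hδ : 0 < δ)
    (ha : DifferentiableAt ℝ a x) (hb : DifferentiableAt ℝ b x)
    (hax : 0 < a x) (hbx : 0 ≤ b x) (ha' : lam / 2 * a x ≤ deriv a x)
    (hb' : deriv b x ≤ (lam - δ) * b x + 2 * K * a x ^ 2) :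
    deriv (fun s ↦ Real.exp (δ * s) * (b s * ((a s)⁻¹ * (a s)⁻¹) - 2 * K / δ)) x ≤ 0 := by
  have hinv := ha.hasDerivAt.fun_inv hax.ne'
  have hexp : HasDerivAt (fun s : ℝ ↦ Real.exp (δ * s)) (Real.exp (δ * x) * δ) x := by
    simpa using ((hasDerivAt_id x).const_mul δ).exp
  have hF := hexp.fun_mul ((hb.hasDerivAt.fun_mul (hinv.fun_mul hinv)).sub_const (2 * K / δ))
  rw [hF.deriv]
  have key : a x * deriv b x + δ * a x * b x - 2 * b x * deriv a x - 2 * K * a x ^ 3 ≤ 0 := by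
    nlinarith [mul_le_mul_of_nonneg_left hb' hax.le, mul_le_mul_of_nonneg_left ha' hbx]
  have hrw : Real.exp (δ * x) * δ * (b x * ((a x)⁻¹ * (a x)⁻¹) - 2 * K / δ) +
      Real.exp (δ * x) * (deriv b x * ((a x)⁻¹ * (a x)⁻¹) +
        b x * (-deriv a x / a x ^ 2 * (a x)⁻¹ + (a x)⁻¹ * (-deriv a x / a x ^ 2))) =
      Real.exp (δ * x) / a x ^ 3 *
        (a x * deriv b x + δ * a x * b x - 2 * b x * deriv a x - 2 * K * a x ^ 3) := by
    field_simp
    ring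
  rw [hrw]
  exact mul_nonpos_of_nonneg_of_nonpos (by positivity) key

/-- Gronwall-type comparison lemma for the GAD instability proof.
If `a, b : [0, s₀] → ℝ` are locally Lipschitz with `a ≥ ε > 0`, `b ≥ 0`, `b(0) = 0`, and for
a.e. `s ∈ [0, s₀)` one has `a′(s) ≥ (λ₀/2)a(s)` and `b′(s) ≤ (λ₀ − δ)b(s) + 2Ka(s)²`, then
`b(s) ≤ (2K/δ)(1 − e^{−δs})a(s)²` on `[0, s₀]`; in particular `b(s)/a(s)² < 2K/δ`. -/
theorem stmt14 (s₀ lam₀ δ K ε : ℝ)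
    (hs₀ : 0 < s₀) (hlam₀ : 0 < lam₀) (hδ : 0 < δ) (hδlt : δ < lam₀) (hK : 0 < K)
    (hε : 0 < ε)
    (a b : ℝ → ℝ)
    (ha_lip : LocallyLipschitzOn (Icc 0 s₀) a)
    (hb_lip : LocallyLipschitzOn (Icc 0 s₀) b)
    (ha_lb : ∀ s ∈ Icc 0 s₀, ε ≤ a s)
    (hb_nonneg : ∀ s ∈ Icc 0 s₀, 0 ≤ b s)
    (hb0 : b 0 = 0)
    (ha' : ∀ᵐ s ∂MeasureTheory.volume, s ∈ Ico 0 s₀ →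
      DifferentiableAt ℝ a s ∧ lam₀ / 2 * a s ≤ deriv a s)
    (hb' : ∀ᵐ s ∂MeasureTheory.volume, s ∈ Ico 0 s₀ →
      DifferentiableAt ℝ b s ∧ deriv b s ≤ (lam₀ - δ) * b s + 2 * K * a s ^ 2) :
    ∀ s ∈ Icc 0 s₀,
      b s ≤ 2 * K / δ * (1 - Real.exp (-δ * s)) * a s ^ 2 ∧
      b s / a s ^ 2 < 2 * K / δ := by
  obtain ⟨A, hA⟩ := ha_lip.exists_lipschitzOnWith_of_compact isCompact_Icc
  obtain ⟨B, hB⟩ := hb_lip.exists_lipschitzOnWith_of_compact isCompact_Icc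
  intro s hs
  have hsub : uIcc 0 s ⊆ Icc 0 s₀ := by
    rw [uIcc_of_le hs.1]
    exact Icc_subset_Icc_right hs.2
  have hac_inv : AbsolutelyContinuousOnInterval (fun x ↦ (a x)⁻¹) 0 s :=
    (((lipschitzOnWith_inv_Ici hε).comp hA ha_lb).mono hsub).absolutelyContinuousOnInterval
  have hac_b : AbsolutelyContinuousOnInterval b 0 s :=
    (hB.mono hsub).absolutelyContinuousOnInterval
  have hac_exp : AbsolutelyContinuousOnInterval (fun x ↦ Real.exp (δ * x)) 0 s :=
    ContDiffOn.absolutelyContinuousOnInterval (by fun_prop)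
  have hac_const : AbsolutelyContinuousOnInterval (fun _ : ℝ ↦ 2 * K / δ) 0 s :=
    ContDiffOn.absolutelyContinuousOnInterval (by fun_prop)
  have hle := (hac_exp.fun_mul ((hac_b.fun_mul (hac_inv.fun_mul hac_inv)).fun_sub
    hac_const)).le_of_ae_deriv_nonpos hs.1 (by
      filter_upwards [ha', hb'] with x hxa hxb hx
      have hx₀ : x ∈ Ico 0 s₀ := ⟨hx.1, hx.2.trans_le hs.2⟩
      have hx₁ := Ico_subset_Icc_self hx₀
      exact deriv_exp_mul_ratio_nonpos hδ (hxa hx₀).1 (hxb hx₀).1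
        (hε.trans_le (ha_lb x hx₁)) (hb_nonneg x hx₁) (hxa hx₀).2 (hxb hx₀).2)
  have has : 0 < a s := hε.trans_le (ha_lb s hs)
  have hE : Real.exp (-δ * s) * Real.exp (δ * s) = 1 := by
    rw [← Real.exp_add]
    simp
  have hratio : b s / a s ^ 2 ≤ 2 * K / δ * (1 - Real.exp (-δ * s)) := by
    have h := mul_le_mul_of_nonneg_left hle (Real.exp_pos (-δ * s)).le
    rw [← mul_assoc, hE, hb0] at h
    simp only [mul_zero, Real.exp_zero, zero_mul, zero_sub, one_mul] at h
    have heq : b s / a s ^ 2 = b s * ((a s)⁻¹ * (a s)⁻¹) := by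
      field_simp
    rw [heq]
    linarith
  refine ⟨(div_le_iff₀ (by positivity)).1 hratio, hratio.trans_lt ?_⟩
  have hpos : 0 < 2 * K / δ * Real.exp (-δ * s) := by positivity
  linarith
end

section
/- Let σ > 0 and K > 0, let α be a real number with 0 < α ≤ min{1, σ²/(16K²)}, and let η be a real number with 0 < η ≤ ασ/(8(1+α)K). Then for all real numbers a, b with 0 ≤ a ≤ η and 0 ≤ b ≤ η: −σa² − ασb² + αK·a·b + K·a·(a² + b²) + αK·b·(a² + b²) ≤ −(σ/2)·(a² + αb²). -/
/-- the elementary inequality behind the energy estimate for the perturbed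
GAD system. For `σ, K > 0`, `0 < α ≤ min{1, σ²/(16K²)}`, `0 < η ≤ ασ/(8(1+α)K)`, and
`0 ≤ a, b ≤ η`:
`−σa² − ασb² + αKab + Ka(a² + b²) + αKb(a² + b²) ≤ −(σ/2)(a² + αb²)`. -/
theorem stmt16 (σ K α η : ℝ) (hσ : 0 < σ) (hK : 0 < K)
    (hα0 : 0 < α) (hα : α ≤ min 1 (σ ^ 2 / (16 * K ^ 2)))
    (hη0 : 0 < η) (hη : η ≤ α * σ / (8 * (1 + α) * K))
    (a b : ℝ) (ha0 : 0 ≤ a) (ha : a ≤ η) (hb0 : 0 ≤ b) (hb : b ≤ η) :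
    -σ * a ^ 2 - α * σ * b ^ 2 + α * K * a * b + K * a * (a ^ 2 + b ^ 2)
        + α * K * b * (a ^ 2 + b ^ 2)
      ≤ -(σ / 2) * (a ^ 2 + α * b ^ 2) := by
  have hα1 : α ≤ 1 := hα.trans (min_le_left _ _)
  have hαK : α * (16 * K ^ 2) ≤ σ ^ 2 :=
    (le_div_iff₀ (by positivity)).mp (hα.trans (min_le_right _ _))
  have hηK : η * (8 * (1 + α) * K) ≤ α * σ := (le_div_iff₀ (by positivity)).mp hη
  have quadratic_bound : α * K * a * b ≤ σ / 8 * (a ^ 2 + α * b ^ 2) := by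
    refine le_of_mul_le_mul_left ?_ hσ
    linarith [sq_nonneg (σ * a - 4 * α * K * b),
      mul_le_mul_of_nonneg_left hαK (mul_nonneg hα0.le (sq_nonneg b))]
  have coefficient_bound : K * (a + α * b) ≤ α * σ / 8 := by
    have hab : a + α * b ≤ (1 + α) * η := by
      linarith [mul_le_mul_of_nonneg_left hb hα0.le]
    linarith [mul_le_mul_of_nonneg_left hab hK.le]
  have cubic_bound : K * (a + α * b) * (a ^ 2 + b ^ 2) ≤ σ / 8 * (a ^ 2 + α * b ^ 2) := by
    have h := mul_le_mul_of_nonneg_right coefficient_bound (by positivity : 0 ≤ a ^ 2 + b ^ 2)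
    linarith [mul_le_mul_of_nonneg_right hα1 (by positivity : 0 ≤ σ * a ^ 2)]
  have energy_nonneg : 0 ≤ σ * (a ^ 2 + α * b ^ 2) := by positivity
  linarith
end
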